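/- Let G = Cay(Γ, S) be an Abelian Cayley graph of degree d = |S|. Then for every integer t ≥ 0, the lazy collision probabilities satisfy CP_t(G) ≤ (2e)^{4d} · CP_{2t}(G). -/

import Mathlib

open Matrix

/-- Normalized adjacency matrix of the Abelian Cayley graph `Cay(Γ, S)`. -/
noncomputable def cayleyAdj {Γ : Type*} [AddCommGroup Γ] [Fintype Γ] [DecidableEq Γ]
    (S : Multiset Γ) : Matrix Γ Γ ℝ :=
  Matrix.of fun x y => (S.count (y - x) : ℝ) / (Multiset.card S : ℝ)

/-- `CP_t(G) = ((½·I + ½·A)^(2t))_{0,0}`: the `t`-step lazy collision probability of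
`Cay(Γ, S)`, at the identity element. -/
noncomputable def lazyCP {Γ : Type*} [AddCommGroup Γ] [Fintype Γ] [DecidableEq Γ]
    (S : Multiset Γ) (t : ℕ) : ℝ :=
  (((1 / 2 : ℝ) • (1 : Matrix Γ Γ ℝ) + (1 / 2 : ℝ) • cayleyAdj S) ^ (2 * t)) 0 0

open Finset

/-! ### A lattice sum -/

theorem exp_neg_sq_div_four_le (v : ℝ) :
    Real.exp (-(v ^ 2 / 4)) ≤
      Real.exp (3 / 16) * Real.exp (-(1 / 4)) ^ (round v).natAbs := by
  rw [← Real.exp_nat_mul, ← Real.exp_add, Real.exp_le_exp, Nat.cast_natAbs, Int.cast_abs]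
  have h := abs_sub_round v
  have h1 : |(round v : ℝ)| ≤ |v| + 1 / 2 := by
    have := abs_sub_abs_le_abs_sub (round v : ℝ) v
    rw [abs_sub_comm] at this
    linarith
  nlinarith [sq_abs v, sq_nonneg (|v| - 1 / 2)]

theorem sum_pow_natAbs_le (A : Finset ℤ) {q : ℝ} (hq0 : 0 ≤ q) (hq1 : q < 1) :
    ∑ m ∈ A, q ^ m.natAbs ≤ (1 + q) / (1 - q) := by
  have h := hasSum_geometric_of_lt_one hq0 hq1
  have h' : HasSum (fun m : ℤ => q ^ m.natAbs) ((1 - q)⁻¹ + q * (1 - q)⁻¹) := by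
    refine HasSum.of_nat_of_neg_add_one (by simpa using h) ?_
    have e : (fun n : ℕ => q ^ (-((n : ℤ) + 1)).natAbs) = fun n => q * q ^ n := by
      funext n
      rw [← pow_succ', Int.natAbs_neg]
      rfl
    rw [e]
    exact h.mul_left q
  calc ∑ m ∈ A, q ^ m.natAbs ≤ (1 - q)⁻¹ + q * (1 - q)⁻¹ :=
        sum_le_hasSum A (fun _ _ => pow_nonneg hq0 _) h'
    _ = (1 + q) / (1 - q) := by ring

theorem exp_mul_geometric_ratio_le :
    Real.exp (3 / 16) * ((1 + Real.exp (-(1 / 4))) / (1 - Real.exp (-(1 / 4)))) ≤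
      4 * Real.exp 1 := by
  have h1 : Real.exp (-(1 / 4)) ≤ 0.78 := by
    have : Real.exp (-(1 / 4)) ^ 4 ≤ 0.78 ^ 4 := by
      rw [← Real.exp_nat_mul]
      norm_num
      rw [Real.exp_neg]
      have := Real.exp_one_gt_d9
      exact (inv_anti₀ (by norm_num) this.le).trans (by norm_num)
    exact le_of_pow_le_pow_left₀ (by norm_num) (by norm_num) this
  have h2 : Real.exp (3 / 16) ≤ 1.25 := by
    have : Real.exp (3 / 16) ^ 16 ≤ 1.25 ^ 16 := by
      rw [← Real.exp_nat_mul]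
      have h3 : Real.exp ((16 : ℕ) * (3 / 16)) = Real.exp 1 ^ 3 := by
        rw [← Real.exp_nat_mul]; norm_num
      rw [h3]
      have := Real.exp_one_lt_d9
      exact (pow_le_pow_left₀ (Real.exp_pos 1).le this.le 3).trans (by norm_num)
    exact le_of_pow_le_pow_left₀ (by norm_num) (by norm_num) this
  have h3 := Real.exp_one_gt_d9
  have h4 : (1 + Real.exp (-(1 / 4))) / (1 - Real.exp (-(1 / 4))) ≤ 8.1 := by
    rw [div_le_iff₀ (by linarith)]; linarith
  nlinarith [Real.exp_pos (3 / 16)]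

theorem sum_exp_round_le (A : Finset ℤ) :
    ∑ m ∈ A, Real.exp (3 / 16) * Real.exp (-(1 / 4)) ^ m.natAbs ≤ 4 * Real.exp 1 := by
  rw [← mul_sum]
  refine le_trans ?_ exp_mul_geometric_ratio_le
  gcongr
  exact sum_pow_natAbs_le A (Real.exp_pos _).le (by rw [Real.exp_lt_one_iff]; norm_num)

/-- If at most `N` of the points `u x` lie in a common translate of a cube around any one of them,
then the Gaussian sum over all the points is at most `N (4e) ^ |J|`. -/
theorem sum_exp_neg_sum_sq_le {X J : Type*} [Fintype X] [Fintype J] (u : X → J → ℝ) (N : ℕ)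
    (hN : ∀ x₀, #{x | ∀ j, |u x j - u x₀ j| ≤ 1} ≤ N) :
    ∑ x, Real.exp (-(∑ j, u x j ^ 2) / 4) ≤ N * (4 * Real.exp 1) ^ Fintype.card J := by
  classical
  set G : ℤ → ℝ := fun m => Real.exp (3 / 16) * Real.exp (-(1 / 4)) ^ m.natAbs with hG
  have hG0 : ∀ m, 0 ≤ G m := fun m => by positivity
  set κ : X → J → ℤ := fun x j => round (u x j) with hκ
  set A : J → Finset ℤ := fun j => univ.image fun x => κ x j with hA
  have hmaps : ∀ x ∈ (univ : Finset X), κ x ∈ Fintype.piFinset A := fun x _ => by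
    simp only [Fintype.mem_piFinset, hA]
    exact fun j => mem_image_of_mem (fun x => κ x j) (mem_univ x)
  have hterm : ∀ x, Real.exp (-(∑ j, u x j ^ 2) / 4) ≤ ∏ j, G (κ x j) := fun x => by
    rw [neg_div, sum_div, ← sum_neg_distrib, Real.exp_sum]
    exact prod_le_prod (fun _ _ => (Real.exp_pos _).le) fun j _ => exp_neg_sq_div_four_le _
  have hfib : ∀ k : J → ℤ, #{x | κ x = k} ≤ N := fun k => by
    rcases (univ.filter fun x => κ x = k).eq_empty_or_nonempty with h | ⟨x₀, hx₀⟩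
    · simp [h]
    · refine (card_le_card fun x hx => ?_).trans (hN x₀)
      simp only [mem_filter, mem_univ, true_and] at hx hx₀ ⊢
      intro j
      have e : (round (u x j) : ℝ) = round (u x₀ j) := by
        exact_mod_cast congrFun (hx.trans hx₀.symm) j
      have h1 := abs_le.1 (abs_sub_round (u x j))
      have h2 := abs_le.1 (abs_sub_round (u x₀ j))
      rw [abs_le]
      constructor <;> linarith
  calc ∑ x, Real.exp (-(∑ j, u x j ^ 2) / 4) ≤ ∑ x, ∏ j, G (κ x j) :=
        sum_le_sum fun x _ => hterm x
    _ = ∑ k ∈ Fintype.piFinset A, ∑ x with κ x = k, ∏ j, G (κ x j) :=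
        (sum_fiberwise_of_maps_to hmaps _).symm
    _ ≤ ∑ k ∈ Fintype.piFinset A, N * ∏ j, G (k j) := by
        refine sum_le_sum fun k _ => ?_
        rw [sum_congr rfl (g := fun _ => ∏ j, G (k j)) fun x hx => by rw [(mem_filter.1 hx).2],
          sum_const, nsmul_eq_mul]
        exact mul_le_mul_of_nonneg_right (by exact_mod_cast hfib k) (prod_nonneg fun j _ => hG0 _)
    _ = N * ∏ j, ∑ m ∈ A j, G m := by rw [← mul_sum, prod_univ_sum]
    _ ≤ N * (4 * Real.exp 1) ^ Fintype.card J := by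
        gcongr
        rw [← card_univ, ← prod_const]
        exact prod_le_prod (fun j _ => sum_nonneg fun m _ => hG0 m) fun j _ => sum_exp_round_le _

/-! ### The spectrum of the lazy walk -/

theorem sum_count_div_card {Γ : Type*} [Fintype Γ] [DecidableEq Γ] {S : Multiset Γ}
    (hS : S ≠ 0) :
    ∑ g, (S.count g : ℝ) / (Multiset.card S : ℝ) = 1 := by
  rw [← sum_div, div_eq_one_iff_eq (by simpa using hS)]
  exact_mod_cast Multiset.sum_count_eq_card fun a _ => mem_univ a

theorem addChar_re_sq_add_im_sq {Γ : Type*} [AddCommGroup Γ] [Finite Γ]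
    (χ : AddChar Γ ℂ) (g : Γ) : (χ g).re ^ 2 + (χ g).im ^ 2 = 1 := by
  have h := Complex.sq_norm (χ g)
  rw [AddChar.norm_apply, Complex.normSq_apply] at h
  linarith

section

variable {Γ : Type*} [AddCommGroup Γ] [Fintype Γ] [DecidableEq Γ]

/-- The eigenvalue of the lazy walk on `Cay(Γ, S)` at the character `χ`. -/
noncomputable def lazyEigenvalue (S : Multiset Γ) (χ : AddChar Γ ℂ) : ℝ :=
  1 / 2 + 1 / 2 * ∑ g, (S.count g : ℝ) / (Multiset.card S : ℝ) * (χ g).re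

theorem sum_count_mul_addChar_neg {S : Multiset Γ} (hsym : ∀ x : Γ, S.count (-x) = S.count x)
    (χ : AddChar Γ ℂ) :
    ∑ g, (((S.count g : ℝ) / (Multiset.card S : ℝ) : ℝ) : ℂ) * χ (-g) =
      ((∑ g, (S.count g : ℝ) / (Multiset.card S : ℝ) * (χ g).re : ℝ) : ℂ) := by
  have h : ∑ g, (((S.count g : ℝ) / (Multiset.card S : ℝ) : ℝ) : ℂ) * χ (-g) =
      ∑ g, (((S.count g : ℝ) / (Multiset.card S : ℝ) : ℝ) : ℂ) * χ g :=
    Fintype.sum_equiv (Equiv.neg Γ) _ _ fun g => by simp [hsym]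
  have h2 : ∑ g, (((S.count g : ℝ) / (Multiset.card S : ℝ) : ℝ) : ℂ) * (χ g + χ (-g)) =
      2 * ((∑ g, (S.count g : ℝ) / (Multiset.card S : ℝ) * (χ g).re : ℝ) : ℂ) := by
    rw [Complex.ofReal_sum, mul_sum]
    refine sum_congr rfl fun g _ => ?_
    rw [AddChar.map_neg_eq_conj, Complex.add_conj]
    push_cast
    ring
  simp only [mul_add, sum_add_distrib] at h2
  linear_combination (1 / 2) * h2 + (1 / 2) * h

theorem lazy_apply (S : Multiset Γ) (x z : Γ) :
    ((1 / 2 : ℝ) • (1 : Matrix Γ Γ ℝ) + (1 / 2 : ℝ) • cayleyAdj S) x z =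
      1 / 2 * (if x = z then 1 else 0) +
        1 / 2 * ((S.count (z - x) : ℝ) / (Multiset.card S : ℝ)) := by
  simp [cayleyAdj, Matrix.one_apply]

theorem sum_lazy_mul_addChar {S : Multiset Γ} (hsym : ∀ x : Γ, S.count (-x) = S.count x)
    (χ : AddChar Γ ℂ) (x y : Γ) :
    ∑ z, ((((1 / 2 : ℝ) • (1 : Matrix Γ Γ ℝ) + (1 / 2 : ℝ) • cayleyAdj S) x z : ℝ) : ℂ) *
      χ (y - z) = lazyEigenvalue S χ * χ (y - x) := by
  have h : ∑ z, (((S.count (z - x) : ℝ) / (Multiset.card S : ℝ) : ℝ) : ℂ) * χ (y - z) =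
      (∑ g, (((S.count g : ℝ) / (Multiset.card S : ℝ) : ℝ) : ℂ) * χ (-g)) * χ (y - x) := by
    rw [sum_mul]
    refine Fintype.sum_equiv (Equiv.subRight x) _ _ fun z => ?_
    rw [mul_assoc, ← AddChar.map_add_eq_mul]
    simp
  rw [sum_count_mul_addChar_neg hsym] at h
  have h1 : ∀ z, ((((1 / 2 : ℝ) • (1 : Matrix Γ Γ ℝ) + (1 / 2 : ℝ) • cayleyAdj S) x z : ℝ) : ℂ) *
      χ (y - z) = (if x = z then 1 / 2 * χ (y - z) else 0) +
        1 / 2 * ((((S.count (z - x) : ℝ) / (Multiset.card S : ℝ) : ℝ) : ℂ) * χ (y - z)) := by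
    intro z
    rw [lazy_apply]
    split_ifs <;> push_cast <;> ring
  rw [sum_congr rfl fun z _ => h1 z, sum_add_distrib, ← mul_sum, h, sum_ite_eq, lazyEigenvalue]
  simp only [mem_univ, if_true]
  push_cast
  ring

theorem lazy_pow_apply {S : Multiset Γ} (hsym : ∀ x : Γ, S.count (-x) = S.count x)
    (k : ℕ) (x y : Γ) :
    (((((1 / 2 : ℝ) • (1 : Matrix Γ Γ ℝ) + (1 / 2 : ℝ) • cayleyAdj S) ^ k) x y : ℝ) : ℂ) =
      (Fintype.card Γ : ℂ)⁻¹ * ∑ χ : AddChar Γ ℂ, (lazyEigenvalue S χ : ℂ) ^ k * χ (y - x) := by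
  induction k generalizing x with
  | zero =>
    simp only [pow_zero, one_mul, AddChar.sum_apply_eq_ite, Matrix.one_apply, sub_eq_zero,
      eq_comm (a := y)]
    split_ifs <;> simp
  | succ k ih =>
    rw [pow_succ', Matrix.mul_apply, Complex.ofReal_sum]
    simp only [Complex.ofReal_mul, ih, mul_sum]
    rw [sum_comm]
    refine sum_congr rfl fun χ _ => ?_
    rw [pow_succ, mul_assoc _ _ (χ (y - x)), ← sum_lazy_mul_addChar hsym, mul_sum, mul_sum]
    exact sum_congr rfl fun z _ => by ring

theorem lazyCP_eq_sum {S : Multiset Γ} (hsym : ∀ x : Γ, S.count (-x) = S.count x) (t : ℕ) :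
    lazyCP S t =
      (Fintype.card Γ : ℝ)⁻¹ * ∑ χ : AddChar Γ ℂ, lazyEigenvalue S χ ^ (2 * t) := by
  have h := lazy_pow_apply hsym (2 * t) 0 0
  simp only [sub_self, AddChar.map_zero_eq_one, mul_one] at h
  apply Complex.ofReal_injective
  rw [lazyCP, h]
  push_cast
  rfl

theorem one_sub_lazyEigenvalue {S : Multiset Γ} (hS : S ≠ 0) (χ : AddChar Γ ℂ) :
    1 - lazyEigenvalue S χ =
      1 / 2 * ∑ g, (S.count g : ℝ) / (Multiset.card S : ℝ) * (1 - (χ g).re) := by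
  simp only [mul_sub, mul_one, sum_sub_distrib, sum_count_div_card hS, lazyEigenvalue]
  ring

theorem lazyEigenvalue_nonneg {S : Multiset Γ} (hS : S ≠ 0) (χ : AddChar Γ ℂ) :
    0 ≤ lazyEigenvalue S χ := by
  have h : ∑ g, (S.count g : ℝ) / (Multiset.card S : ℝ) * (1 - (χ g).re) ≤
      ∑ g, (S.count g : ℝ) / (Multiset.card S : ℝ) * 2 := by
    refine sum_le_sum fun g _ => mul_le_mul_of_nonneg_left ?_ (by positivity)
    nlinarith [addChar_re_sq_add_im_sq χ g, sq_nonneg (χ g).im]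
  rw [← sum_mul, sum_count_div_card hS] at h
  linarith [one_sub_lazyEigenvalue hS χ]

theorem lazyEigenvalue_le_one {S : Multiset Γ} (hS : S ≠ 0) (χ : AddChar Γ ℂ) :
    lazyEigenvalue S χ ≤ 1 := by
  have h : 0 ≤ ∑ g, (S.count g : ℝ) / (Multiset.card S : ℝ) * (1 - (χ g).re) := by
    refine sum_nonneg fun g _ => mul_nonneg (by positivity) ?_
    nlinarith [addChar_re_sq_add_im_sq χ g, sq_nonneg (χ g).im]
  linarith [one_sub_lazyEigenvalue hS χ]

theorem lazyCP_le_one {S : Multiset Γ} (hS : S ≠ 0)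
    (hsym : ∀ x : Γ, S.count (-x) = S.count x) (t : ℕ) : lazyCP S t ≤ 1 := by
  rw [lazyCP_eq_sum hsym, inv_mul_le_one₀ (by exact_mod_cast Fintype.card_pos)]
  calc ∑ χ : AddChar Γ ℂ, lazyEigenvalue S χ ^ (2 * t) ≤ ∑ _χ : AddChar Γ ℂ, (1 : ℝ) :=
        sum_le_sum fun χ _ =>
          pow_le_one₀ (lazyEigenvalue_nonneg hS χ) (lazyEigenvalue_le_one hS χ)
    _ = Fintype.card Γ := by simp [AddChar.card_eq]

theorem half_pow_le_lazy_pow (S : Multiset Γ) (k : ℕ) :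
    (∀ x y, 0 ≤ (((1 / 2 : ℝ) • (1 : Matrix Γ Γ ℝ) + (1 / 2 : ℝ) • cayleyAdj S) ^ k) x y) ∧
      ∀ x, (1 / 2 : ℝ) ^ k ≤
        (((1 / 2 : ℝ) • (1 : Matrix Γ Γ ℝ) + (1 / 2 : ℝ) • cayleyAdj S) ^ k) x x := by
  set M := (1 / 2 : ℝ) • (1 : Matrix Γ Γ ℝ) + (1 / 2 : ℝ) • cayleyAdj S with hM
  have hnn : ∀ x y, 0 ≤ M x y := fun x y => by
    rw [hM, lazy_apply]; split_ifs <;> positivity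
  have hdiag : ∀ x, 1 / 2 ≤ M x x := fun x => by
    rw [hM, lazy_apply, if_pos rfl, mul_one]
    exact le_add_of_nonneg_right (by positivity)
  induction k with
  | zero =>
    refine ⟨fun x y => ?_, fun x => by simp⟩
    rw [pow_zero, Matrix.one_apply]; split_ifs <;> simp
  | succ k ih =>
    refine ⟨fun x y => ?_, fun x => ?_⟩
    · rw [pow_succ, Matrix.mul_apply]
      exact sum_nonneg fun z _ => mul_nonneg (ih.1 x z) (hnn z y)
    · rw [pow_succ, pow_succ, Matrix.mul_apply]
      calc (1 / 2 : ℝ) ^ k * (1 / 2) ≤ (M ^ k) x x * M x x :=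
            mul_le_mul (ih.2 x) (hdiag x) (by norm_num) (ih.1 x x)
        _ ≤ ∑ z, (M ^ k) x z * M z x :=
            single_le_sum (f := fun z => (M ^ k) x z * M z x)
              (fun z _ => mul_nonneg (ih.1 x z) (hnn z x)) (mem_univ x)

theorem lazyEigenvalue_pow_le_exp {S : Multiset Γ} (hS : S ≠ 0) (χ : AddChar Γ ℂ) (k : ℕ) :
    lazyEigenvalue S χ ^ k ≤
      Real.exp (-(k / (4 * Multiset.card S) *
        ∑ g : S.toFinset, ((1 - (χ g).re) ^ 2 + (χ g).im ^ 2))) := by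
  have h0 : lazyEigenvalue S χ ≤ Real.exp (-(1 - lazyEigenvalue S χ)) := by
    linarith [Real.add_one_le_exp (-(1 - lazyEigenvalue S χ))]
  refine (pow_le_pow_left₀ (lazyEigenvalue_nonneg hS χ) h0 k).trans ?_
  rw [← Real.exp_nat_mul, Real.exp_le_exp, mul_neg, neg_le_neg_iff, one_sub_lazyEigenvalue hS,
    div_mul_eq_mul_div, mul_div_assoc]
  refine mul_le_mul_of_nonneg_left ?_ (Nat.cast_nonneg k)
  have hd : (0 : ℝ) < Multiset.card S := by exact_mod_cast Multiset.card_pos.2 hS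
  rw [sum_coe_sort S.toFinset fun g => (1 - (χ g).re) ^ 2 + (χ g).im ^ 2, sum_div, mul_sum]
  have hpos : ∀ g, 0 ≤ 1 - (χ g).re := fun g => by
    nlinarith [addChar_re_sq_add_im_sq χ g, sq_nonneg (χ g).im]
  calc ∑ g ∈ S.toFinset, ((1 - (χ g).re) ^ 2 + (χ g).im ^ 2) / (4 * Multiset.card S)
      ≤ ∑ g ∈ S.toFinset, 1 / 2 * ((S.count g : ℝ) / Multiset.card S * (1 - (χ g).re)) := by
        refine sum_le_sum fun g hg => ?_
        have hc : (1 : ℝ) ≤ S.count g := by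
          exact_mod_cast Multiset.one_le_count_iff_mem.2 (Multiset.mem_toFinset.1 hg)
        have e : (1 - (χ g).re) ^ 2 + (χ g).im ^ 2 = 2 * (1 - (χ g).re) := by
          linear_combination addChar_re_sq_add_im_sq χ g
        rw [e, div_le_iff₀ (by positivity)]
        field_simp
        nlinarith [hpos g]
    _ ≤ ∑ g, 1 / 2 * ((S.count g : ℝ) / Multiset.card S * (1 - (χ g).re)) :=
        sum_le_sum_of_subset_of_nonneg (subset_univ _) fun g _ _ =>
          mul_nonneg (by norm_num) (mul_nonneg (by positivity) (hpos g))

theorem one_sub_lazyEigenvalue_sub_le {S : Multiset Γ} (hS : S ≠ 0) (χ ψ : AddChar Γ ℂ) {r : ℝ}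
    (h : ∀ g ∈ S, ((χ g).re - (ψ g).re) ^ 2 + ((χ g).im - (ψ g).im) ^ 2 ≤ 2 * r) :
    1 - lazyEigenvalue S (χ - ψ) ≤ r / 2 := by
  have hre : ∀ g, ((χ - ψ) g).re = (χ g).re * (ψ g).re + (χ g).im * (ψ g).im := fun g => by
    have e : (χ - ψ) g = χ g * (starRingEnd ℂ) (ψ g) := by
      rw [AddChar.sub_apply, AddChar.map_neg_eq_conj]
    simp [e]
  have key : ∑ g, (S.count g : ℝ) / (Multiset.card S : ℝ) * (1 - ((χ - ψ) g).re) ≤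
      ∑ g, (S.count g : ℝ) / (Multiset.card S : ℝ) * r := by
    refine sum_le_sum fun g _ => ?_
    by_cases hg : g ∈ S
    · refine mul_le_mul_of_nonneg_left ?_ (by positivity)
      rw [hre]
      nlinarith [h g hg, addChar_re_sq_add_im_sq χ g, addChar_re_sq_add_im_sq ψ g]
    · simp [Multiset.count_eq_zero_of_notMem hg]
  rw [← sum_mul, sum_count_div_card hS] at key
  linarith [one_sub_lazyEigenvalue hS (χ - ψ)]

theorem sum_lazyEigenvalue_pow_le {S : Multiset Γ} (hS : S ≠ 0) {t : ℕ} (ht : 0 < t) :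
    ∑ χ : AddChar Γ ℂ, lazyEigenvalue S χ ^ (2 * t) ≤
      #{χ : AddChar Γ ℂ | 1 - lazyEigenvalue S χ ≤ Multiset.card S / (4 * t)} *
        (4 * Real.exp 1) ^ (2 * Multiset.card S) := by
  have hd : (0 : ℝ) < Multiset.card S := by exact_mod_cast Multiset.card_pos.2 hS
  have ht' : (0 : ℝ) < t := by exact_mod_cast ht
  set w : ℝ := √(Multiset.card S / (2 * t)) with hw
  have hw0 : 0 < w := Real.sqrt_pos.2 (by positivity)
  have hw2 : w ^ 2 = Multiset.card S / (2 * t) := Real.sq_sqrt (by positivity)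
  set u : AddChar Γ ℂ → S.toFinset × Bool → ℝ := fun χ j =>
    bif j.2 then (1 - (χ j.1).re) / w else (χ j.1).im / w with hu
  have hN : ∀ ψ, #{χ | ∀ j, |u χ j - u ψ j| ≤ 1} ≤
      #{χ : AddChar Γ ℂ | 1 - lazyEigenvalue S χ ≤ Multiset.card S / (4 * t)} := by
    intro ψ
    refine card_le_card_of_injOn (fun χ => χ - ψ) (fun χ hχ => ?_) (sub_left_injective.injOn)
    simp only [coe_filter, mem_univ, true_and, Set.mem_ofPred_eq] at hχ ⊢
    have := one_sub_lazyEigenvalue_sub_le hS χ ψ (r := w ^ 2) fun g hg => by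
      have h1 := hχ (⟨g, Multiset.mem_toFinset.2 hg⟩, true)
      have h2 := hχ (⟨g, Multiset.mem_toFinset.2 hg⟩, false)
      simp only [hu, cond_true, cond_false, ← sub_div, abs_div, abs_of_pos hw0,
        div_le_one hw0] at h1 h2
      have h1' := sq_le_sq' (abs_le.1 h1).1 (abs_le.1 h1).2
      have h2' := sq_le_sq' (abs_le.1 h2).1 (abs_le.1 h2).2
      linarith
    refine this.trans_eq ?_
    rw [hw2]
    ring
  refine (sum_le_sum fun χ _ => ?_).trans ((sum_exp_neg_sum_sq_le u _ hN).trans ?_)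
  · refine (lazyEigenvalue_pow_le_exp hS χ (2 * t)).trans_eq ?_
    congr 1
    rw [neg_div, neg_inj, Fintype.sum_prod_type, mul_sum, sum_div]
    refine sum_congr rfl fun g _ => ?_
    simp only [hu, Fintype.sum_bool, cond_true, cond_false, div_pow, hw2]
    push_cast
    field_simp
  · refine mul_le_mul_of_nonneg_left (pow_le_pow_right₀ ?_ ?_) (Nat.cast_nonneg _)
    · linarith [Real.add_one_le_exp 1]
    · rw [Fintype.card_prod, Fintype.card_coe, Fintype.card_bool, mul_comm]
      exact Nat.mul_le_mul_left 2 S.toFinset_card_le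

theorem card_mul_exp_le_sum_lazyEigenvalue_pow {S : Multiset Γ} (hS : S ≠ 0) {t : ℕ}
    (ht : 0 < t) (hdt : Multiset.card S ≤ 2 * t) :
    #{χ : AddChar Γ ℂ | 1 - lazyEigenvalue S χ ≤ Multiset.card S / (4 * t)} *
        Real.exp (-(2 * Multiset.card S)) ≤
      ∑ χ : AddChar Γ ℂ, lazyEigenvalue S χ ^ (2 * (2 * t)) := by
  have ht' : (0 : ℝ) < t := by exact_mod_cast ht
  set x : ℝ := Multiset.card S / (4 * t) with hx
  have hx0 : 0 ≤ x := by positivity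
  have hx1 : x ≤ 1 / 2 := by
    have : (Multiset.card S : ℝ) ≤ 2 * t := by exact_mod_cast hdt
    rw [hx, div_le_iff₀ (by positivity)]
    linarith
  have hexp : Real.exp (-(2 * x)) ≤ 1 - x := by
    rw [Real.exp_neg]
    refine inv_le_of_inv_le₀ (by linarith) (le_trans ?_ (Real.add_one_le_exp (2 * x)))
    rw [inv_le_iff_one_le_mul₀ (by linarith)]
    nlinarith
  have hpow : Real.exp (-(2 * Multiset.card S)) = Real.exp (-(2 * x)) ^ (2 * (2 * t)) := by
    rw [← Real.exp_nat_mul, hx]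
    congr 1
    push_cast
    field_simp
    ring
  rw [← nsmul_eq_mul, ← sum_const, hpow]
  refine (sum_le_sum fun χ hχ => ?_).trans
    (sum_le_sum_of_subset_of_nonneg (subset_univ _) fun χ _ _ =>
      pow_nonneg (lazyEigenvalue_nonneg hS χ) _)
  have := (mem_filter.1 hχ).2
  exact pow_le_pow_left₀ (Real.exp_pos _).le (by linarith) _

end

/-- Let `G = Cay(Γ, S)` be an Abelian Cayley graph of degree `d = |S|`
(with symmetric generating multiset `S`). Then for every integer `t ≥ 0`,
`CP_t(G) ≤ (2e)^(4d) · CP_{2t}(G)`. -/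
theorem collision_probability_slow_decay
    {Γ : Type*} [AddCommGroup Γ] [Fintype Γ] [DecidableEq Γ]
    (S : Multiset Γ) (hS : S ≠ 0) (hsym : ∀ x : Γ, S.count (-x) = S.count x) (t : ℕ) :
    lazyCP S t ≤ (2 * Real.exp 1) ^ (4 * Multiset.card S) * lazyCP S (2 * t) := by
  rcases le_total t (2 * Multiset.card S) with h | h
  · have hlow : (1 / 2 : ℝ) ^ (8 * Multiset.card S) ≤ lazyCP S (2 * t) :=
      (pow_le_pow_of_le_one (by norm_num) (by norm_num) (by lia)).trans
        ((half_pow_le_lazy_pow S (2 * (2 * t))).2 0)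
    have hone : (1 : ℝ) ≤ (2 * Real.exp 1) ^ (4 * Multiset.card S) *
        (1 / 2) ^ (8 * Multiset.card S) := by
      rw [show 8 * Multiset.card S = 2 * (4 * Multiset.card S) by ring,
        pow_mul (1 / 2 : ℝ), ← mul_pow]
      exact one_le_pow₀ (by linarith [Real.add_one_le_exp 1])
    calc lazyCP S t ≤ 1 := lazyCP_le_one hS hsym t
      _ ≤ _ := hone
      _ ≤ _ := by gcongr
  · have hd := Multiset.card_pos.2 hS
    have hup := sum_lazyEigenvalue_pow_le hS (t := t) (by lia)
    have hlow := card_mul_exp_le_sum_lazyEigenvalue_pow hS (t := t) (by lia) (by lia)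
    have hconst : (2 * Real.exp 1) ^ (4 * Multiset.card S) *
        Real.exp (-(2 * Multiset.card S)) = (4 * Real.exp 1) ^ (2 * Multiset.card S) := by
      have he : Real.exp (-(2 * Multiset.card S)) * Real.exp 1 ^ (2 * Multiset.card S) = 1 := by
        rw [← Real.exp_nat_mul, ← Real.exp_add]
        simp
      rw [mul_pow, mul_pow, show 4 * Multiset.card S = 2 * (2 * Multiset.card S) by ring,
        pow_mul 2 2, mul_comm 2 (2 * Multiset.card S), pow_mul (Real.exp 1) _ 2]
      norm_num only
      linear_combination (4 : ℝ) ^ (2 * Multiset.card S) *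
        Real.exp 1 ^ (2 * Multiset.card S) * he
    rw [lazyCP_eq_sum hsym, lazyCP_eq_sum hsym, mul_left_comm]
    refine mul_le_mul_of_nonneg_left (hup.trans ?_) (by positivity)
    rw [← hconst, mul_left_comm]
    exact mul_le_mul_of_nonneg_left hlow (by positivity)
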